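/- In the network setup, the network problem admits a non-stationary traveling wave at profile level if and only if the following condition (T) holds: there exist ℓ_1^±, …, ℓ_m^± ∈ [0,1] with ℓ_i⁻ < ℓ_i⁺ for every i ∈ I such that (i) I₀ᶜ := {i ∈ I : f_i(ℓ_i⁻) ≠ f_i(ℓ_i⁺)} ≠ ∅; (ii) for every j ∈ J there exist ℓ_j^± ∈ [0,1] with f_j(ℓ_j⁻) ≠ f_j(ℓ_j⁺) and f_j(ℓ_j^±) = Σ_{i∈I} α_{i,j} f_i(L_{i,j}^±); (iii) for every j ∈ J and almost every ξ ∈ ℝ, γ_j(ℓ_j(c_j ξ)) = Σ_{i∈I₀ᶜ} A_{i,j} c_{i,j} γ_i(φ_i(c_i ξ)), where the φ_i are profiles for the incoming roads, ℓ_j(ξ) = Σ_{i∈I₀ᶜ} A_{i,j} φ_i(c_{i,j} ξ) − k_j, and γ_h(ℓ) = (g_h(ℓ) − g_h(ℓ_h⁻))/D_h(ℓ) when D_h(ℓ) ≠ 0 and γ_h(ℓ) = 0 when D_h(ℓ) = 0. -/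

import Mathlib

open Set Filter MeasureTheory
open scoped Topology Classical

/-- Assumption (f): `f ∈ C¹([0,1];ℝ)` is nonnegative, strictly concave, `f 0 = f 1 = 0`. -/
def FluxAssumption (f : ℝ → ℝ) : Prop :=
  ContDiffOn ℝ 1 f (Icc 0 1) ∧ StrictConcaveOn ℝ (Icc 0 1) f ∧
  (∀ x ∈ Icc (0:ℝ) 1, 0 ≤ f x) ∧ f 0 = 0 ∧ f 1 = 0

/-- Assumption (D): `D ∈ C¹([0,1];ℝ)` is nonnegative and positive on `(0,1)`. -/
def DiffAssumption (D : ℝ → ℝ) : Prop :=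
  ContDiffOn ℝ 1 D (Icc 0 1) ∧ (∀ x ∈ Icc (0:ℝ) 1, 0 ≤ D x) ∧
  (∀ x ∈ Ioo (0:ℝ) 1, 0 < D x)

/-- The wave speed `c = (f(ℓ⁺) - f(ℓ⁻))/(ℓ⁺ - ℓ⁻)`. -/
noncomputable def waveSpeed (f : ℝ → ℝ) (a b : ℝ) : ℝ := (f b - f a) / (b - a)

/-- The reduced flux `g(ρ) = f(ρ) - c ρ`. -/
noncomputable def redFlux (f : ℝ → ℝ) (a b ρ : ℝ) : ℝ := f ρ - waveSpeed f a b * ρ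

/-- A profile for data `f, D, ℓ⁻ = a, ℓ⁺ = b`: continuous, non-decreasing, with values in
`[a,b]`, limits `a` at `-∞` and `b` at `+∞`, `C²` on `I = {ξ | a < φ ξ < b}` with positive
derivative there, satisfying `D(φ) φ' = g(φ) - g(a)` on `I`. -/
def IsProfile (f D : ℝ → ℝ) (a b : ℝ) (φ : ℝ → ℝ) : Prop :=
  Continuous φ ∧ Monotone φ ∧ (∀ ξ, φ ξ ∈ Icc a b) ∧
  Tendsto φ atBot (𝓝 a) ∧ Tendsto φ atTop (𝓝 b) ∧
  ContDiffOn ℝ 2 φ {ξ | a < φ ξ ∧ φ ξ < b} ∧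
  ∀ ξ, a < φ ξ → φ ξ < b →
    0 < deriv φ ξ ∧ D (φ ξ) * deriv φ ξ = redFlux f a b (φ ξ) - redFlux f a b a

/-- Speed of road `h` given end–state functions. -/
noncomputable def spd {H : Type*} (f : H → ℝ → ℝ) (lm lp : H → ℝ) (h : H) : ℝ :=
  waveSpeed (f h) (lm h) (lp h)

/-- Reduced flux of road `h` given end–state functions. -/
noncomputable def gred {H : Type*} (f : H → ℝ → ℝ) (lm lp : H → ℝ) (h : H) (ρ : ℝ) : ℝ :=
  redFlux (f h) (lm h) (lp h) ρ

/-- The network setup: flux/diffusivity assumptions on each road, and coefficients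
`α i j ∈ (0,1]` with unit row sums. -/
def NetworkSetup {m n : ℕ} (f D : Fin m ⊕ Fin n → ℝ → ℝ) (α : Fin m → Fin n → ℝ) : Prop :=
  (∀ h, FluxAssumption (f h)) ∧ (∀ h, DiffAssumption (D h)) ∧
  (∀ i j, α i j ∈ Ioc (0:ℝ) 1) ∧ (∀ i, ∑ j, α i j = 1)

/-- Admissible end states: `0 ≤ ℓ_h⁻ < ℓ_h⁺ ≤ 1` for every road. -/
def EndStates {H : Type*} (lm lp : H → ℝ) : Prop :=
  ∀ h, 0 ≤ lm h ∧ lm h < lp h ∧ lp h ≤ 1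

/-- The coupling condition (Tool):
`c_j φ_j(c_j t) + g_j(ℓ_j⁻) = ∑_i α_{i,j} (c_i φ_i(c_i t) + g_i(ℓ_i⁻))` for all `t, j`. -/
def Tool {m n : ℕ} (f : Fin m ⊕ Fin n → ℝ → ℝ) (α : Fin m → Fin n → ℝ)
    (lm lp : Fin m ⊕ Fin n → ℝ) (φ : Fin m ⊕ Fin n → ℝ → ℝ) : Prop :=
  ∀ t : ℝ, ∀ j : Fin n,
    spd f lm lp (Sum.inr j) * φ (Sum.inr j) (spd f lm lp (Sum.inr j) * t)
      + gred f lm lp (Sum.inr j) (lm (Sum.inr j))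
    = ∑ i : Fin m, α i j *
        (spd f lm lp (Sum.inl i) * φ (Sum.inl i) (spd f lm lp (Sum.inl i) * t)
          + gred f lm lp (Sum.inl i) (lm (Sum.inl i)))

/-- A traveling wave of the network problem at profile level: a family of profiles
satisfying the coupling condition (Tool). -/
def IsTravelingWave {m n : ℕ} (f D : Fin m ⊕ Fin n → ℝ → ℝ) (α : Fin m → Fin n → ℝ)
    (lm lp : Fin m ⊕ Fin n → ℝ) (φ : Fin m ⊕ Fin n → ℝ → ℝ) : Prop :=
  (∀ h, IsProfile (f h) (D h) (lm h) (lp h) (φ h)) ∧ Tool f α lm lp φ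

/-- `L_{i,j}⁻`: `ℓ_i⁻` if `c_i c_j ≥ 0`, and `ℓ_i⁺` otherwise. -/
noncomputable def Lminus {m n : ℕ} (f : Fin m ⊕ Fin n → ℝ → ℝ)
    (lm lp : Fin m ⊕ Fin n → ℝ) (i : Fin m) (j : Fin n) : ℝ :=
  if 0 ≤ spd f lm lp (Sum.inl i) * spd f lm lp (Sum.inr j) then lm (Sum.inl i)
  else lp (Sum.inl i)

/-- `L_{i,j}⁺`: `ℓ_i⁺` if `c_i c_j ≥ 0`, and `ℓ_i⁻` otherwise. -/
noncomputable def Lplus {m n : ℕ} (f : Fin m ⊕ Fin n → ℝ → ℝ)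
    (lm lp : Fin m ⊕ Fin n → ℝ) (i : Fin m) (j : Fin n) : ℝ :=
  if 0 ≤ spd f lm lp (Sum.inl i) * spd f lm lp (Sum.inr j) then lp (Sum.inl i)
  else lm (Sum.inl i)

/-- `k_j = ∑_{i ∈ I₀ᶜ} A_{i,j} L_{i,j}⁻ - ℓ_j⁻` with `A_{i,j} = α_{i,j} c_i / c_j`. -/
noncomputable def kconst {m n : ℕ} (f : Fin m ⊕ Fin n → ℝ → ℝ) (α : Fin m → Fin n → ℝ)
    (lm lp : Fin m ⊕ Fin n → ℝ) (j : Fin n) : ℝ :=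
  (∑ i ∈ Finset.univ.filter (fun i : Fin m => spd f lm lp (Sum.inl i) ≠ 0),
      (α i j * (spd f lm lp (Sum.inl i) / spd f lm lp (Sum.inr j))) * Lminus f lm lp i j)
    - lm (Sum.inr j)

/-- The extended quotient `γ(ℓ) = (g(ℓ) - g(ℓ⁻))/D(ℓ)`, set to `0` where `D` vanishes. -/
noncomputable def gammaFun (f D : ℝ → ℝ) (a b : ℝ) (ℓ : ℝ) : ℝ :=
  if D ℓ = 0 then 0 else (redFlux f a b ℓ - redFlux f a b a) / D ℓ

lemma ws_mul (f : ℝ → ℝ) {a b : ℝ} (h : a < b) : waveSpeed f a b * (b - a) = f b - f a := by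
  unfold waveSpeed
  have : b - a ≠ 0 := by linarith [sub_pos.2 h] |> fun h : 0 < b - a => h.ne'
  field_simp

lemma redFlux_end (f : ℝ → ℝ) {a b : ℝ} (h : a < b) : redFlux f a b b = redFlux f a b a := by
  have := ws_mul f h
  unfold redFlux
  linarith

lemma gamma_left (f D : ℝ → ℝ) (a b : ℝ) : gammaFun f D a b a = 0 := by
  unfold gammaFun; simp

lemma gamma_right (f D : ℝ → ℝ) {a b : ℝ} (h : a < b) : gammaFun f D a b b = 0 := by
  unfold gammaFun; simp [redFlux_end f h]

lemma const_deriv_off {φ : ℝ → ℝ} (hm : Monotone φ) (a b : ℝ) (hab : a < b)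
    (hr : ∀ ξ, φ ξ ∈ Icc a b) :
    ({ξ | φ ξ = a ∧ ¬ ∀ᶠ y in 𝓝 ξ, φ y = a} ∪
      {ξ | φ ξ = b ∧ ¬ ∀ᶠ y in 𝓝 ξ, φ y = b}).Countable := by
  apply Set.Countable.union
  · apply Set.Subsingleton.countable
    have key : ∀ x y, φ y = a → x < y → ∀ᶠ z in 𝓝 x, φ z = a := by
      intro x y hy hxy
      filter_upwards [Iio_mem_nhds hxy] with z hz
      exact le_antisymm (hy ▸ hm (le_of_lt hz)) (hr z).1
    rintro x ⟨hx, hx'⟩ y ⟨hy, hy'⟩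
    rcases lt_trichotomy x y with h | h | h
    · exact absurd (key x y hy h) hx'
    · exact h
    · exact absurd (key y x hx h) hy'
  · apply Set.Subsingleton.countable
    have key : ∀ x y, φ y = b → y < x → ∀ᶠ z in 𝓝 x, φ z = b := by
      intro x y hy hxy
      filter_upwards [Ioi_mem_nhds hxy] with z hz
      exact le_antisymm (hr z).2 (hy ▸ hm (le_of_lt hz))
    rintro x ⟨hx, hx'⟩ y ⟨hy, hy'⟩
    rcases lt_trichotomy x y with h | h | h
    · exact absurd (key y x hx h) hy'
    · exact h
    · exact absurd (key x y hy h) hx'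

lemma prof_deriv {f D : ℝ → ℝ} {a b : ℝ} {φ : ℝ → ℝ} (hD : DiffAssumption D)
    (ha : 0 ≤ a) (hab : a < b) (hb : b ≤ 1) (hφ : IsProfile f D a b φ) :
    ∃ S : Set ℝ, S.Countable ∧ ∀ ξ, ξ ∉ S → HasDerivAt φ (gammaFun f D a b (φ ξ)) ξ := by
  obtain ⟨hc, hm, hr, -, -, hs, ho⟩ := hφ
  refine ⟨_, const_deriv_off hm a b hab hr, fun ξ hξ => ?_⟩
  simp only [mem_union, mem_setOf_eq, not_or, not_and, not_not] at hξ
  rcases (hr ξ).1.eq_or_lt with h1 | h1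
  · rw [← h1, gamma_left]
    exact (hasDerivAt_const ξ a).congr_of_eventuallyEq (hξ.1 h1.symm)
  rcases (hr ξ).2.eq_or_lt with h2 | h2
  · rw [h2, gamma_right f D hab]
    exact (hasDerivAt_const ξ b).congr_of_eventuallyEq (hξ.2 h2)
  obtain ⟨hp, he⟩ := ho ξ h1 h2
  have hDp : D (φ ξ) ≠ 0 := (hD.2.2 _ ⟨by linarith, by linarith⟩).ne'
  have : gammaFun f D a b (φ ξ) = deriv φ ξ := by
    unfold gammaFun
    rw [if_neg hDp, ← he]; field_simp
  rw [this]
  exact (differentiableAt_of_deriv_ne_zero hp.ne').hasDerivAt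

lemma redFlux_pos {f : ℝ → ℝ} {a b : ℝ} (hf : FluxAssumption f)
    (ha : 0 ≤ a) (hab : a < b) (hb : b ≤ 1) {x : ℝ} (h1 : a < x) (h2 : x < b) :
    0 < redFlux f a b x - redFlux f a b a := by
  have hs := hf.2.1.slope_anti_adjacent (x := a) (y := x) (z := b)
    ⟨ha, by linarith⟩ ⟨by linarith, hb⟩ h1 h2
  have hw := ws_mul f hab
  set c := waveSpeed f a b
  rw [div_lt_div_iff₀ (by linarith) (by linarith)] at hs
  unfold redFlux
  change 0 < f x - c * x - (f a - c * a)
  have : 0 < (f x - f a) * (b - a) - (f b - f a) * (x - a) := by nlinarith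
  rw [← hw] at this
  have h3 : 0 < (f x - c * x - (f a - c * a)) * (b - a) := by nlinarith
  exact pos_of_mul_pos_left h3 (by linarith)

lemma gamma_contDiffOn {f D : ℝ → ℝ} {a b : ℝ} (hf : FluxAssumption f) (hD : DiffAssumption D)
    (ha : 0 ≤ a) (hb : b ≤ 1) : ContDiffOn ℝ 1 (gammaFun f D a b) (Ioo a b) := by
  have hsub : Ioo a b ⊆ Icc (0:ℝ) 1 := fun x hx => ⟨by linarith [hx.1], by linarith [hx.2]⟩
  have hpos : ∀ x ∈ Ioo a b, D x ≠ 0 := fun x hx =>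
    (hD.2.2 x ⟨by linarith [hx.1], by linarith [hx.2]⟩).ne'
  have : ContDiffOn ℝ 1 (fun x => (redFlux f a b x - redFlux f a b a) / D x) (Ioo a b) := by
    apply ContDiffOn.div _ (hD.1.mono hsub) hpos
    apply ContDiffOn.sub _ contDiffOn_const
    unfold redFlux
    exact (hf.1.mono hsub).sub (contDiffOn_const.mul contDiffOn_id)
  refine this.congr fun x hx => ?_
  unfold gammaFun
  rw [if_neg (hpos x hx)]

lemma outProfile {f D : ℝ → ℝ} {a b : ℝ} {ψ ψ' : ℝ → ℝ} (hf : FluxAssumption f)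
    (hD : DiffAssumption D) (ha : 0 ≤ a) (hab : a < b) (hb : b ≤ 1)
    (hc : Continuous ψ) (hm : Monotone ψ) (hbot : Tendsto ψ atBot (𝓝 a))
    (htop : Tendsto ψ atTop (𝓝 b)) {S : Set ℝ} (hS : S.Countable)
    (hd : ∀ ξ, ξ ∉ S → HasDerivAt ψ (ψ' ξ) ξ)
    (hae : ∀ᵐ ξ ∂(volume : Measure ℝ), gammaFun f D a b (ψ ξ) = ψ' ξ) :
    IsProfile f D a b ψ := by
  have hr : ∀ ξ, ψ ξ ∈ Icc a b := fun ξ => ⟨hm.le_of_tendsto hbot ξ, hm.ge_of_tendsto htop ξ⟩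
  have hopen : IsOpen {ξ | a < ψ ξ ∧ ψ ξ < b} :=
    (isOpen_lt continuous_const hc).inter (isOpen_lt hc continuous_const)
  have hγ := gamma_contDiffOn hf hD ha hb (a := a) (b := b)
  have hmaps : MapsTo ψ {ξ | a < ψ ξ ∧ ψ ξ < b} (Ioo a b) := fun ξ h => h
  have hγc : ContinuousOn (fun ξ => gammaFun f D a b (ψ ξ)) {ξ | a < ψ ξ ∧ ψ ξ < b} :=
    hγ.continuousOn.comp hc.continuousOn hmaps
  have hder : ∀ ξ ∈ {ξ | a < ψ ξ ∧ ψ ξ < b}, HasDerivAt ψ (gammaFun f D a b (ψ ξ)) ξ := by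
    intro ξ hξ
    obtain ⟨ε, hε, hball⟩ := Metric.isOpen_iff.1 hopen ξ hξ
    have hFTC : ∀ x ∈ Metric.ball ξ ε,
        ψ x = ψ ξ + ∫ t in ξ..x, gammaFun f D a b (ψ t) := by
      intro x hx
      have hsub : uIcc ξ x ⊆ Metric.ball ξ ε := by
        rw [Real.ball_eq_Ioo] at hx ⊢
        exact (ordConnected_Ioo).uIcc_subset ⟨by linarith, by linarith⟩ hx
      have hint : IntervalIntegrable (fun t => gammaFun f D a b (ψ t)) volume ξ x :=
        (hγc.mono (hsub.trans hball)).intervalIntegrable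
      have hint' : IntervalIntegrable ψ' volume ξ x :=
        hint.congr_ae (ae_restrict_of_ae hae)
      have h1 := integral_eq_of_hasDerivAt_off_countable ψ ψ' hS
        hc.continuousOn (fun y hy => hd y hy.2) hint'
      have h2 : ∫ t in ξ..x, gammaFun f D a b (ψ t) = ∫ t in ξ..x, ψ' t :=
        intervalIntegral.integral_congr_ae (by filter_upwards [hae] with t ht _ using ht)
      rw [h2, h1]; ring
    have hnh : {ξ | a < ψ ξ ∧ ψ ξ < b} ∈ 𝓝 ξ := hopen.mem_nhds hξ
    have h3 : HasDerivAt (fun x => ∫ t in ξ..x, gammaFun f D a b (ψ t))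
        (gammaFun f D a b (ψ ξ)) ξ := by
      apply intervalIntegral.integral_hasDerivAt_right
      · simp
      · exact hγc.stronglyMeasurableAtFilter hopen ξ hξ
      · exact hγc.continuousAt hnh
    have h4 := h3.const_add (ψ ξ)
    refine h4.congr_of_eventuallyEq ?_
    filter_upwards [Metric.ball_mem_nhds ξ hε] with x hx using hFTC x hx
  refine ⟨hc, hm, hr, hbot, htop, ?_, ?_⟩
  · have hdiff : DifferentiableOn ℝ ψ {ξ | a < ψ ξ ∧ ψ ξ < b} :=
      fun ξ h => (hder ξ h).differentiableAt.differentiableWithinAt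
    have hC1 : ContDiffOn ℝ 1 ψ {ξ | a < ψ ξ ∧ ψ ξ < b} := by
      rw [show (1 : WithTop ℕ∞) = 0 + 1 by simp, contDiffOn_succ_iff_deriv_of_isOpen hopen]
      refine ⟨hdiff, by simp, ?_⟩
      exact (contDiffOn_zero.2 hγc).congr fun ξ h => (hder ξ h).deriv
    rw [show (2 : WithTop ℕ∞) = 1 + 1 by norm_num, contDiffOn_succ_iff_deriv_of_isOpen hopen]
    refine ⟨hdiff, by simp, ?_⟩
    exact (hγ.comp hC1 hmaps).congr fun ξ h => (hder ξ h).deriv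
  · intro ξ h1 h2
    have hp := redFlux_pos hf ha hab hb h1 h2
    have hDp : 0 < D (ψ ξ) := hD.2.2 _ ⟨by linarith, by linarith⟩
    rw [(hder ξ ⟨h1, h2⟩).deriv]
    unfold gammaFun
    rw [if_neg hDp.ne']
    exact ⟨div_pos hp hDp, by field_simp⟩

lemma ae_scale {P : ℝ → Prop} {c : ℝ} (hc : c ≠ 0) (h : ∀ᵐ ξ ∂(volume : Measure ℝ), P ξ) :
    ∀ᵐ ξ ∂(volume : Measure ℝ), P (c * ξ) := by
  rw [ae_iff] at h ⊢
  have := Real.volume_preimage_mul_left hc {ξ | ¬ P ξ}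
  rw [h, mul_zero] at this
  exact this

lemma countable_scale {S : Set ℝ} {c : ℝ} (hc : c ≠ 0) (h : S.Countable) :
    {ξ | c * ξ ∈ S}.Countable :=
  h.preimage (mul_right_injective₀ hc)

lemma lim_bot {f D : ℝ → ℝ} {a b : ℝ} {φ : ℝ → ℝ} (hφ : IsProfile f D a b φ) (c : ℝ) :
    Tendsto (fun t => c * φ (c * t)) atBot (𝓝 (c * if 0 ≤ c then a else b)) := by
  obtain ⟨-, -, -, hb, ht, -⟩ := hφ
  rcases lt_trichotomy c 0 with h | h | h
  · rw [if_neg (not_le.2 h)]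
    exact (ht.comp (tendsto_id.const_mul_atBot_of_neg h)).const_mul c
  · simp [h]
  · rw [if_pos h.le]
    exact (hb.comp (tendsto_id.const_mul_atBot h)).const_mul c

lemma lim_top {f D : ℝ → ℝ} {a b : ℝ} {φ : ℝ → ℝ} (hφ : IsProfile f D a b φ) (c : ℝ) :
    Tendsto (fun t => c * φ (c * t)) atTop (𝓝 (c * if 0 ≤ c then b else a)) := by
  obtain ⟨-, -, -, hb, ht, -⟩ := hφ
  rcases lt_trichotomy c 0 with h | h | h
  · rw [if_neg (not_le.2 h)]
    exact (hb.comp (tendsto_id.const_mul_atTop_of_neg h)).const_mul c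
  · simp [h]
  · rw [if_pos h.le]
    exact (ht.comp (tendsto_id.const_mul_atTop h)).const_mul c

lemma mono_scale {φ : ℝ → ℝ} (hm : Monotone φ) (c : ℝ) : Monotone (fun t => c * φ (c * t)) := by
  intro x y hxy
  rcases le_total 0 c with h | h
  · exact mul_le_mul_of_nonneg_left (hm (mul_le_mul_of_nonneg_left hxy h)) h
  · exact mul_le_mul_of_nonpos_left (hm (mul_le_mul_of_nonpos_left hxy h)) h

lemma div_nonneg_iff_mul (x y : ℝ) (hy : y ≠ 0) : 0 ≤ x / y ↔ 0 ≤ x * y := by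
  have h : x * y = (x / y) * (y * y) := by field_simp
  have h2 : 0 < y * y := mul_self_pos.2 hy
  rw [h]
  exact (mul_nonneg_iff_of_pos_right h2).symm

/-- `α c L⁻ + α g(ℓ⁻) = α f(L⁻)` and its variant for `L⁺`. -/
lemma flux_at (f : ℝ → ℝ) {a b : ℝ} (h : a < b) (p : Prop) [Decidable p] :
    waveSpeed f a b * (if p then a else b) + redFlux f a b a = f (if p then a else b) := by
  split_ifs
  · unfold redFlux; ring
  · rw [← redFlux_end f h]; unfold redFlux; ring

lemma flux_at' (f : ℝ → ℝ) {a b : ℝ} (h : a < b) (p : Prop) [Decidable p] :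
    waveSpeed f a b * (if p then b else a) + redFlux f a b a = f (if p then b else a) := by
  split_ifs
  · rw [← redFlux_end f h]; unfold redFlux; ring
  · unfold redFlux; ring

lemma sum_filter_spd {m n : ℕ} (f : Fin m ⊕ Fin n → ℝ → ℝ) (α : Fin m → Fin n → ℝ)
    (lm lp : Fin m ⊕ Fin n → ℝ) (j : Fin n) (X : Fin m → ℝ)
    (hc : spd f lm lp (Sum.inr j) ≠ 0) :
    spd f lm lp (Sum.inr j) *
      ∑ i ∈ Finset.univ.filter (fun i : Fin m => spd f lm lp (Sum.inl i) ≠ 0),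
        (α i j * (spd f lm lp (Sum.inl i) / spd f lm lp (Sum.inr j))) * X i
    = ∑ i, α i j * (spd f lm lp (Sum.inl i) * X i) := by
  rw [Finset.sum_filter, Finset.mul_sum]
  refine Finset.sum_congr rfl fun i _ => ?_
  split_ifs with h
  · field_simp
  · push Not at h
    rw [h]; ring

lemma kconst_eq {m n : ℕ} (f : Fin m ⊕ Fin n → ℝ → ℝ) (α : Fin m → Fin n → ℝ)
    (lm lp : Fin m ⊕ Fin n → ℝ) (j : Fin n)
    (hl : ∀ i : Fin m, lm (Sum.inl i) < lp (Sum.inl i))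
    (hc : spd f lm lp (Sum.inr j) ≠ 0)
    (hbal : f (Sum.inr j) (lm (Sum.inr j))
            = ∑ i : Fin m, α i j * f (Sum.inl i) (Lminus f lm lp i j)) :
    spd f lm lp (Sum.inr j) * kconst f α lm lp j
      = gred f lm lp (Sum.inr j) (lm (Sum.inr j))
        - ∑ i, α i j * gred f lm lp (Sum.inl i) (lm (Sum.inl i)) := by
  unfold kconst
  rw [mul_sub, sum_filter_spd f α lm lp j _ hc]
  have h1 : gred f lm lp (Sum.inr j) (lm (Sum.inr j))
      = f (Sum.inr j) (lm (Sum.inr j)) - spd f lm lp (Sum.inr j) * lm (Sum.inr j) := rfl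
  rw [h1, hbal, sub_right_comm]
  congr 1
  rw [← Finset.sum_sub_distrib]
  refine Finset.sum_congr rfl fun i _ => ?_
  have := flux_at (f (Sum.inl i)) (hl i)
    (0 ≤ spd f lm lp (Sum.inl i) * spd f lm lp (Sum.inr j))
  unfold Lminus
  rw [← this]
  unfold gred spd
  ring

/-- The candidate outgoing profile. -/
noncomputable def lam {m n : ℕ} (f : Fin m ⊕ Fin n → ℝ → ℝ) (α : Fin m → Fin n → ℝ)
    (lm lp : Fin m ⊕ Fin n → ℝ) (φin : Fin m → ℝ → ℝ) (j : Fin n) (ξ : ℝ) : ℝ :=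
  (∑ i ∈ Finset.univ.filter (fun i : Fin m => spd f lm lp (Sum.inl i) ≠ 0),
    (α i j * (spd f lm lp (Sum.inl i) / spd f lm lp (Sum.inr j))) *
      φin i ((spd f lm lp (Sum.inl i) / spd f lm lp (Sum.inr j)) * ξ)) - kconst f α lm lp j

lemma lam_eq {m n : ℕ} (f : Fin m ⊕ Fin n → ℝ → ℝ) (α : Fin m → Fin n → ℝ)
    (lm lp : Fin m ⊕ Fin n → ℝ) (φin : Fin m → ℝ → ℝ) (j : Fin n)
    (hl : ∀ i : Fin m, lm (Sum.inl i) < lp (Sum.inl i))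
    (hc : spd f lm lp (Sum.inr j) ≠ 0)
    (hbal : f (Sum.inr j) (lm (Sum.inr j))
            = ∑ i : Fin m, α i j * f (Sum.inl i) (Lminus f lm lp i j)) (t : ℝ) :
    spd f lm lp (Sum.inr j) * lam f α lm lp φin j (spd f lm lp (Sum.inr j) * t)
      + gred f lm lp (Sum.inr j) (lm (Sum.inr j))
    = ∑ i : Fin m, α i j *
        (spd f lm lp (Sum.inl i) * φin i (spd f lm lp (Sum.inl i) * t)
          + gred f lm lp (Sum.inl i) (lm (Sum.inl i))) := by
  unfold lam
  rw [mul_sub, kconst_eq f α lm lp j hl hc hbal, sum_filter_spd f α lm lp j _ hc]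
  simp only [mul_add, Finset.sum_add_distrib]
  have : ∀ i : Fin m, spd f lm lp (Sum.inl i) / spd f lm lp (Sum.inr j) *
      (spd f lm lp (Sum.inr j) * t) = spd f lm lp (Sum.inl i) * t := by
    intro i; field_simp
  simp only [this]
  ring

lemma lam_deriv {m n : ℕ} (f D : Fin m ⊕ Fin n → ℝ → ℝ) (α : Fin m → Fin n → ℝ)
    (lm lp : Fin m ⊕ Fin n → ℝ) (φin : Fin m → ℝ → ℝ) (j : Fin n)
    (hD : ∀ h, DiffAssumption (D h))
    (hl : ∀ i : Fin m, 0 ≤ lm (Sum.inl i) ∧ lm (Sum.inl i) < lp (Sum.inl i) ∧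
          lp (Sum.inl i) ≤ 1)
    (hc : spd f lm lp (Sum.inr j) ≠ 0)
    (hφ : ∀ i : Fin m, IsProfile (f (Sum.inl i)) (D (Sum.inl i))
            (lm (Sum.inl i)) (lp (Sum.inl i)) (φin i)) :
    ∃ S : Set ℝ, S.Countable ∧ ∀ ξ, ξ ∉ S → HasDerivAt (lam f α lm lp φin j)
      (∑ i ∈ Finset.univ.filter (fun i : Fin m => spd f lm lp (Sum.inl i) ≠ 0),
        (α i j * (spd f lm lp (Sum.inl i) / spd f lm lp (Sum.inr j))) *
          ((spd f lm lp (Sum.inl i) / spd f lm lp (Sum.inr j)) *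
            gammaFun (f (Sum.inl i)) (D (Sum.inl i)) (lm (Sum.inl i)) (lp (Sum.inl i))
              (φin i ((spd f lm lp (Sum.inl i) / spd f lm lp (Sum.inr j)) * ξ)))) ξ := by
  have hS := fun i => prof_deriv (hD (Sum.inl i)) (hl i).1 (hl i).2.1 (hl i).2.2 (hφ i)
  choose S hSc hSd using hS
  refine ⟨⋃ i ∈ Finset.univ.filter (fun i : Fin m => spd f lm lp (Sum.inl i) ≠ 0),
    {ξ | (spd f lm lp (Sum.inl i) / spd f lm lp (Sum.inr j)) * ξ ∈ S i}, ?_, ?_⟩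
  · apply Set.Countable.biUnion (Finset.countable_toSet _)
    intro i hi
    exact countable_scale (div_ne_zero (Finset.mem_filter.1 hi).2 hc) (hSc i)
  · intro ξ hξ
    simp only [mem_iUnion, not_exists] at hξ
    unfold lam
    apply HasDerivAt.sub_const
    apply HasDerivAt.fun_sum
    intro i hi
    apply HasDerivAt.const_mul
    have h1 := hSd i _ (hξ i hi)
    have h2 : HasDerivAt (fun ξ : ℝ => (spd f lm lp (Sum.inl i) / spd f lm lp (Sum.inr j)) * ξ)
      (spd f lm lp (Sum.inl i) / spd f lm lp (Sum.inr j)) ξ := by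
      simpa using (hasDerivAt_id ξ).const_mul
        (spd f lm lp (Sum.inl i) / spd f lm lp (Sum.inr j))
    have h3 := h1.comp ξ h2
    rw [mul_comm] at h3
    exact h3

/-- The limits of `Tool` at `±∞`. -/
lemma tool_lims {m n : ℕ} {f D : Fin m ⊕ Fin n → ℝ → ℝ} {α : Fin m → Fin n → ℝ}
    {lm lp : Fin m ⊕ Fin n → ℝ} {φ : Fin m ⊕ Fin n → ℝ → ℝ} (he : EndStates lm lp)
    (hw : IsTravelingWave f D α lm lp φ) (j : Fin n) :
    f (Sum.inr j) (if 0 ≤ spd f lm lp (Sum.inr j) then lm (Sum.inr j) else lp (Sum.inr j))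
      = ∑ i, α i j * f (Sum.inl i)
        (if 0 ≤ spd f lm lp (Sum.inl i) then lm (Sum.inl i) else lp (Sum.inl i)) ∧
    f (Sum.inr j) (if 0 ≤ spd f lm lp (Sum.inr j) then lp (Sum.inr j) else lm (Sum.inr j))
      = ∑ i, α i j * f (Sum.inl i)
        (if 0 ≤ spd f lm lp (Sum.inl i) then lp (Sum.inl i) else lm (Sum.inl i)) := by
  obtain ⟨hp, ht⟩ := hw
  have ht' := fun t => ht t j
  constructor
  · have L := (lim_bot (hp (Sum.inr j)) (spd f lm lp (Sum.inr j))).add_const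
      (gred f lm lp (Sum.inr j) (lm (Sum.inr j)))
    have R := tendsto_finsetSum (Finset.univ : Finset (Fin m)) (fun i _ =>
      ((lim_bot (hp (Sum.inl i)) (spd f lm lp (Sum.inl i))).add_const
      (gred f lm lp (Sum.inl i) (lm (Sum.inl i)))).const_mul (α i j))
    have := tendsto_nhds_unique (L.congr ht') R
    have e := fun h => flux_at (f h) (he h).2.1 (0 ≤ spd f lm lp h)
    unfold gred at this
    have e' : ∀ h, spd f lm lp h * (if 0 ≤ spd f lm lp h then lm h else lp h)
      + redFlux (f h) (lm h) (lp h) (lm h) = f h (if 0 ≤ spd f lm lp h then lm h else lp h) := e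
    simpa only [e'] using this
  · have L := (lim_top (hp (Sum.inr j)) (spd f lm lp (Sum.inr j))).add_const
      (gred f lm lp (Sum.inr j) (lm (Sum.inr j)))
    have R := tendsto_finsetSum (Finset.univ : Finset (Fin m)) (fun i _ =>
      ((lim_top (hp (Sum.inl i)) (spd f lm lp (Sum.inl i))).add_const
      (gred f lm lp (Sum.inl i) (lm (Sum.inl i)))).const_mul (α i j))
    have := tendsto_nhds_unique (L.congr ht') R
    have e := fun h => flux_at' (f h) (he h).2.1 (0 ≤ spd f lm lp h)
    unfold gred at this
    have e' : ∀ h, spd f lm lp h * (if 0 ≤ spd f lm lp h then lp h else lm h)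
      + redFlux (f h) (lm h) (lp h) (lm h) = f h (if 0 ≤ spd f lm lp h then lp h else lm h) := e
    simpa only [e'] using this

lemma spd_abs {m n : ℕ} (f : Fin m ⊕ Fin n → ℝ → ℝ)
    (lm lp : Fin m ⊕ Fin n → ℝ) (h : Fin m ⊕ Fin n) (hl : lm h < lp h) :
    f h (if 0 ≤ spd f lm lp h then lp h else lm h)
      - f h (if 0 ≤ spd f lm lp h then lm h else lp h) = |spd f lm lp h| * (lp h - lm h) := by
  have hw : spd f lm lp h * (lp h - lm h) = _ := ws_mul (f h) hl
  split_ifs with h0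
  · rw [abs_of_nonneg h0, hw]
  · rw [abs_of_neg (not_le.1 h0), neg_mul, hw]; ring

lemma spd_zero_flux {m n : ℕ} (f : Fin m ⊕ Fin n → ℝ → ℝ)
    (lm lp : Fin m ⊕ Fin n → ℝ) (h : Fin m ⊕ Fin n) (hl : lm h < lp h)
    (h0 : spd f lm lp h = 0) : f h (lp h) = f h (lm h) := by
  have hw : spd f lm lp h * (lp h - lm h) = _ := ws_mul (f h) hl
  rw [h0] at hw; linarith

theorem forward {m n : ℕ} {f D : Fin m ⊕ Fin n → ℝ → ℝ} {α : Fin m → Fin n → ℝ}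
    (hnet : NetworkSetup f D α)
    {lm lp : Fin m ⊕ Fin n → ℝ} {φ : Fin m ⊕ Fin n → ℝ → ℝ} (he : EndStates lm lp)
    (hw : IsTravelingWave f D α lm lp φ) (hns : ∃ h, spd f lm lp h ≠ 0) :
    (∃ i : Fin m, spd f lm lp (Sum.inl i) ≠ 0) ∧
    (∀ j : Fin n, spd f lm lp (Sum.inr j) ≠ 0 ∧
      f (Sum.inr j) (lm (Sum.inr j))
            = ∑ i : Fin m, α i j * f (Sum.inl i) (Lminus f lm lp i j) ∧
          f (Sum.inr j) (lp (Sum.inr j))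
            = ∑ i : Fin m, α i j * f (Sum.inl i) (Lplus f lm lp i j)) := by
  obtain ⟨hf, hD, hα, -⟩ := hnet
  have key : ∀ j : Fin n, |spd f lm lp (Sum.inr j)| * (lp (Sum.inr j) - lm (Sum.inr j))
      = ∑ i : Fin m, α i j * (|spd f lm lp (Sum.inl i)| * (lp (Sum.inl i) - lm (Sum.inl i))) := by
    intro j
    obtain ⟨h1, h2⟩ := tool_lims he hw j
    rw [← spd_abs f lm lp _ (he _).2.1, h1, h2, ← Finset.sum_sub_distrib]
    refine Finset.sum_congr rfl fun i _ => ?_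
    rw [← spd_abs f lm lp _ (he _).2.1]; ring
  have hI : ∃ i : Fin m, spd f lm lp (Sum.inl i) ≠ 0 := by
    by_contra! hcon
    obtain ⟨h, hh⟩ := hns
    rcases h with i | j
    · exact hh (hcon i)
    · have := key j
      simp only [hcon, abs_zero, zero_mul, mul_zero, Finset.sum_const_zero] at this
      rcases mul_eq_zero.1 this with h | h
      · exact hh (abs_eq_zero.1 h)
      · linarith [(he (Sum.inr j)).2.1]
  refine ⟨hI, fun j => ?_⟩
  have hcj : spd f lm lp (Sum.inr j) ≠ 0 := by
    intro h0
    have := key j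
    rw [h0, abs_zero, zero_mul] at this
    obtain ⟨i0, hi0⟩ := hI
    have hpos : 0 < ∑ i : Fin m, α i j *
        (|spd f lm lp (Sum.inl i)| * (lp (Sum.inl i) - lm (Sum.inl i))) := by
      apply Finset.sum_pos'
      · intro i _
        exact mul_nonneg (hα i j).1.le (mul_nonneg (abs_nonneg _)
          (sub_nonneg.2 (he (Sum.inl i)).2.1.le))
      · exact ⟨i0, Finset.mem_univ _, mul_pos (hα i0 j).1 (mul_pos (abs_pos.2 hi0)
          (sub_pos.2 (he (Sum.inl i0)).2.1))⟩
    linarith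
  refine ⟨hcj, ?_⟩
  obtain ⟨h1, h2⟩ := tool_lims he hw j
  rcases lt_or_gt_of_ne hcj with hj | hj
  · rw [if_neg (not_le.2 hj)] at h1 h2
    rw [h1, h2]
    constructor <;>
    · refine Finset.sum_congr rfl fun i _ => ?_
      congr 1
      have hz := spd_zero_flux f lm lp (Sum.inl i) (he _).2.1
      simp only [Lminus, Lplus]
      rcases lt_trichotomy (spd f lm lp (Sum.inl i)) 0 with h | h | h
      · have h3 : 0 ≤ spd f lm lp (Sum.inl i) * spd f lm lp (Sum.inr j) :=
          (mul_pos_of_neg_of_neg h hj).le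
        rw [if_neg (not_le.2 h), if_pos h3]
      · simp [h, hz h]
      · have h3 : ¬ 0 ≤ spd f lm lp (Sum.inl i) * spd f lm lp (Sum.inr j) :=
          not_le.2 (mul_neg_of_pos_of_neg h hj)
        rw [if_pos h.le, if_neg h3]
  · rw [if_pos hj.le] at h1 h2
    rw [h1, h2]
    unfold Lminus Lplus
    simp only [mul_nonneg_iff_of_pos_right hj, and_self]

theorem backward {m n : ℕ} {f D : Fin m ⊕ Fin n → ℝ → ℝ} {α : Fin m → Fin n → ℝ}
    (hnet : NetworkSetup f D α)
    {lm lp : Fin m ⊕ Fin n → ℝ} {φin : Fin m → ℝ → ℝ} 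
    (hl : ∀ i : Fin m, 0 ≤ lm (Sum.inl i) ∧ lm (Sum.inl i) < lp (Sum.inl i) ∧
          lp (Sum.inl i) ≤ 1)
    (hI : ∃ i : Fin m, spd f lm lp (Sum.inl i) ≠ 0) (j : Fin n)
    (hm : lm (Sum.inr j) ∈ Icc (0:ℝ) 1) (hp : lp (Sum.inr j) ∈ Icc (0:ℝ) 1)
    (hne : f (Sum.inr j) (lm (Sum.inr j)) ≠ f (Sum.inr j) (lp (Sum.inr j)))
    (hb1 : f (Sum.inr j) (lm (Sum.inr j))
            = ∑ i : Fin m, α i j * f (Sum.inl i) (Lminus f lm lp i j))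
    (hb2 : f (Sum.inr j) (lp (Sum.inr j))
            = ∑ i : Fin m, α i j * f (Sum.inl i) (Lplus f lm lp i j))
    (hφ : ∀ i : Fin m, IsProfile (f (Sum.inl i)) (D (Sum.inl i))
            (lm (Sum.inl i)) (lp (Sum.inl i)) (φin i))
    (hae : ∀ᵐ ξ ∂(volume : Measure ℝ),
            gammaFun (f (Sum.inr j)) (D (Sum.inr j)) (lm (Sum.inr j)) (lp (Sum.inr j))
              (lam f α lm lp φin j (spd f lm lp (Sum.inr j) * ξ))
            = ∑ i ∈ Finset.univ.filter (fun i : Fin m => spd f lm lp (Sum.inl i) ≠ 0),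
                (α i j * (spd f lm lp (Sum.inl i) / spd f lm lp (Sum.inr j))) *
                  ((spd f lm lp (Sum.inl i) / spd f lm lp (Sum.inr j)) *
                    gammaFun (f (Sum.inl i)) (D (Sum.inl i)) (lm (Sum.inl i)) (lp (Sum.inl i))
                      (φin i (spd f lm lp (Sum.inl i) * ξ)))) :
    lm (Sum.inr j) < lp (Sum.inr j) ∧ spd f lm lp (Sum.inr j) ≠ 0 ∧
      IsProfile (f (Sum.inr j)) (D (Sum.inr j)) (lm (Sum.inr j)) (lp (Sum.inr j))
        (lam f α lm lp φin j) := by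
  obtain ⟨hf, hD, hα, -⟩ := hnet
  have hlne : lp (Sum.inr j) - lm (Sum.inr j) ≠ 0 := by
    intro h
    exact hne (by rw [show lp (Sum.inr j) = lm (Sum.inr j) by linarith])
  have hcj : spd f lm lp (Sum.inr j) ≠ 0 :=
    div_ne_zero (sub_ne_zero.2 hne.symm) hlne
  have hcw : spd f lm lp (Sum.inr j) * (lp (Sum.inr j) - lm (Sum.inr j))
      = f (Sum.inr j) (lp (Sum.inr j)) - f (Sum.inr j) (lm (Sum.inr j)) := by
    unfold spd waveSpeed
    field_simp
  have hdiff : spd f lm lp (Sum.inr j) * (lp (Sum.inr j) - lm (Sum.inr j))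
      = ∑ i, α i j * (spd f lm lp (Sum.inl i) * (Lplus f lm lp i j - Lminus f lm lp i j)) := by
    rw [hcw, hb1, hb2, ← Finset.sum_sub_distrib]
    refine Finset.sum_congr rfl fun i _ => ?_
    have e1 := flux_at (f (Sum.inl i)) (hl i).2.1
      (0 ≤ spd f lm lp (Sum.inl i) * spd f lm lp (Sum.inr j))
    have e2 := flux_at' (f (Sum.inl i)) (hl i).2.1
      (0 ≤ spd f lm lp (Sum.inl i) * spd f lm lp (Sum.inr j))
    unfold Lplus Lminus
    rw [← e1, ← e2]
    unfold spd
    ring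
  have hlt : lm (Sum.inr j) < lp (Sum.inr j) := by
    have h1 : 0 < spd f lm lp (Sum.inr j) *
        (spd f lm lp (Sum.inr j) * (lp (Sum.inr j) - lm (Sum.inr j))) := by
      rw [hdiff, Finset.mul_sum]
      have ht : ∀ i, spd f lm lp (Sum.inr j) * (α i j * (spd f lm lp (Sum.inl i) *
          (Lplus f lm lp i j - Lminus f lm lp i j))) =
          α i j * (|spd f lm lp (Sum.inl i) * spd f lm lp (Sum.inr j)| *
            (lp (Sum.inl i) - lm (Sum.inl i))) := by
        intro i
        unfold Lplus Lminus
        split_ifs with h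
        · rw [abs_of_nonneg h]; ring
        · rw [abs_of_neg (not_le.1 h)]; ring
      simp only [ht]
      obtain ⟨i0, hi0⟩ := hI
      apply Finset.sum_pos'
      · intro i _
        exact mul_nonneg (hα i j).1.le (mul_nonneg (abs_nonneg _)
          (sub_nonneg.2 (hl i).2.1.le))
      · exact ⟨i0, Finset.mem_univ _, mul_pos (hα i0 j).1 (mul_pos
          (abs_pos.2 (mul_ne_zero hi0 hcj)) (sub_pos.2 (hl i0).2.1))⟩
    rw [← mul_assoc] at h1
    have := pos_of_mul_pos_right h1 (mul_self_nonneg _)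
    linarith
  refine ⟨hlt, hcj, ?_⟩
  obtain ⟨S, hS, hSd⟩ := lam_deriv f D α lm lp φin j hD hl hcj hφ
  have hform : lam f α lm lp φin j = fun ξ =>
      (∑ i ∈ Finset.univ.filter (fun i : Fin m => spd f lm lp (Sum.inl i) ≠ 0),
        α i j * ((spd f lm lp (Sum.inl i) / spd f lm lp (Sum.inr j)) *
      φin i ((spd f lm lp (Sum.inl i) / spd f lm lp (Sum.inr j)) * ξ))) - kconst f α lm lp j := by
    funext ξ
    unfold lam
    simp only [mul_assoc]
  have hk : (∑ i ∈ Finset.univ.filter (fun i : Fin m => spd f lm lp (Sum.inl i) ≠ 0),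
      (α i j * (spd f lm lp (Sum.inl i) / spd f lm lp (Sum.inr j))) * Lminus f lm lp i j)
      - kconst f α lm lp j = lm (Sum.inr j) := by
    unfold kconst; ring
  have hk' : (∑ i ∈ Finset.univ.filter (fun i : Fin m => spd f lm lp (Sum.inl i) ≠ 0),
      (α i j * (spd f lm lp (Sum.inl i) / spd f lm lp (Sum.inr j))) * Lplus f lm lp i j)
      - kconst f α lm lp j = lp (Sum.inr j) := by
    have := sum_filter_spd f α lm lp j (fun i => Lplus f lm lp i j - Lminus f lm lp i j) hcj
    rw [← hdiff] at this
    have := mul_left_cancel₀ hcj this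
    simp only [mul_sub, Finset.sum_sub_distrib] at this hk ⊢
    linarith
  refine outProfile (hf _) (hD _) hm.1 hlt hp.2 ?_ ?_ ?_ ?_ hS hSd ?_
  · unfold lam
    apply Continuous.sub _ continuous_const
    refine continuous_finsetSum _ fun i _ => ?_
    exact continuous_const.mul ((hφ i).1.comp (continuous_const.mul continuous_id))
  · rw [hform]
    intro x y hxy
    refine sub_le_sub_right (Finset.sum_le_sum fun i _ => ?_) _
    exact mul_le_mul_of_nonneg_left (mono_scale (hφ i).2.1 _ hxy) (hα i j).1.le
  · rw [hform, ← hk]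
    apply Tendsto.sub_const
    refine tendsto_finsetSum _ fun i _ => ?_
    have := (lim_bot (hφ i) (spd f lm lp (Sum.inl i) / spd f lm lp (Sum.inr j))).const_mul (α i j)
    simp only [div_nonneg_iff_mul _ _ hcj] at this
    rw [mul_assoc]
    exact this
  · rw [hform, ← hk']
    apply Tendsto.sub_const
    refine tendsto_finsetSum _ fun i _ => ?_
    have := (lim_top (hφ i) (spd f lm lp (Sum.inl i) / spd f lm lp (Sum.inr j))).const_mul (α i j)
    simp only [div_nonneg_iff_mul _ _ hcj] at this
    rw [mul_assoc]
    exact this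
  · have := ae_scale (inv_ne_zero hcj) hae
    filter_upwards [this] with ξ hξ
    rw [mul_inv_cancel_left₀ hcj] at hξ
    rw [hξ]
    refine Finset.sum_congr rfl fun i _ => ?_
    rw [← mul_assoc (spd f lm lp (Sum.inl i)), ← div_eq_mul_inv]

/-- Main theorem: the network problem admits a non-stationary traveling wave if and only if
condition (T) holds. -/
theorem stmt14 (m n : ℕ) (hm : 0 < m) (hn : 0 < n)
    (f D : Fin m ⊕ Fin n → ℝ → ℝ) (α : Fin m → Fin n → ℝ)
    (hnet : NetworkSetup f D α) :
    (∃ (lm lp : Fin m ⊕ Fin n → ℝ) (φ : Fin m ⊕ Fin n → ℝ → ℝ),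
        EndStates lm lp ∧ IsTravelingWave f D α lm lp φ ∧
        ∃ h, spd f lm lp h ≠ 0) ↔
    (∃ lm lp : Fin m ⊕ Fin n → ℝ,
        (∀ i : Fin m, 0 ≤ lm (Sum.inl i) ∧ lm (Sum.inl i) < lp (Sum.inl i) ∧
          lp (Sum.inl i) ≤ 1) ∧
        -- (i) `I₀ᶜ ≠ ∅`
        (∃ i : Fin m, spd f lm lp (Sum.inl i) ≠ 0) ∧
        -- (ii) outgoing end states in `[0,1]` with nonzero speed, satisfying the balance
        (∀ j : Fin n,
          lm (Sum.inr j) ∈ Icc (0:ℝ) 1 ∧ lp (Sum.inr j) ∈ Icc (0:ℝ) 1 ∧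
          f (Sum.inr j) (lm (Sum.inr j)) ≠ f (Sum.inr j) (lp (Sum.inr j)) ∧
          f (Sum.inr j) (lm (Sum.inr j))
            = ∑ i : Fin m, α i j * f (Sum.inl i) (Lminus f lm lp i j) ∧
          f (Sum.inr j) (lp (Sum.inr j))
            = ∑ i : Fin m, α i j * f (Sum.inl i) (Lplus f lm lp i j)) ∧
        -- (iii) the compatibility condition (RATM) for some incoming profiles
        (∃ φin : Fin m → ℝ → ℝ,
          (∀ i : Fin m, IsProfile (f (Sum.inl i)) (D (Sum.inl i))
            (lm (Sum.inl i)) (lp (Sum.inl i)) (φin i)) ∧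
          ∀ j : Fin n, ∀ᵐ ξ ∂(volume : Measure ℝ),
            gammaFun (f (Sum.inr j)) (D (Sum.inr j)) (lm (Sum.inr j)) (lp (Sum.inr j))
              ((∑ i ∈ Finset.univ.filter (fun i : Fin m => spd f lm lp (Sum.inl i) ≠ 0),
                  (α i j * (spd f lm lp (Sum.inl i) / spd f lm lp (Sum.inr j))) *
                    φin i ((spd f lm lp (Sum.inl i) / spd f lm lp (Sum.inr j)) *
                      (spd f lm lp (Sum.inr j) * ξ)))
                - kconst f α lm lp j)
            = ∑ i ∈ Finset.univ.filter (fun i : Fin m => spd f lm lp (Sum.inl i) ≠ 0),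
                (α i j * (spd f lm lp (Sum.inl i) / spd f lm lp (Sum.inr j))) *
                  ((spd f lm lp (Sum.inl i) / spd f lm lp (Sum.inr j)) *
                    gammaFun (f (Sum.inl i)) (D (Sum.inl i)) (lm (Sum.inl i)) (lp (Sum.inl i))
                      (φin i (spd f lm lp (Sum.inl i) * ξ))))) := by
  constructor
  · rintro ⟨lm, lp, φ, he, hw, hns⟩
    obtain ⟨hI, hJ⟩ := forward hnet he hw hns
    refine ⟨lm, lp, fun i => he _, hI, fun j => ?_, fun i => φ (Sum.inl i), fun i => hw.1 _, ?_⟩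
    · obtain ⟨hc, h1, h2⟩ := hJ j
      obtain ⟨e1, e2, e3⟩ := he (Sum.inr j)
      refine ⟨⟨e1, by linarith⟩, ⟨by linarith, e3⟩, ?_, h1, h2⟩
      intro h
      apply hc
      unfold spd waveSpeed
      rw [h, sub_self, zero_div]
    · intro j
      obtain ⟨hc, h1, -⟩ := hJ j
      have hfun : φ (Sum.inr j) = lam f α lm lp (fun i => φ (Sum.inl i)) j := by
        funext ξ
        have a1 := hw.2 (ξ / spd f lm lp (Sum.inr j)) j
        have a2 := lam_eq f α lm lp (fun i => φ (Sum.inl i)) j (fun i => (he _).2.1) hc h1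
          (ξ / spd f lm lp (Sum.inr j))
        rw [← a2, mul_div_cancel₀ _ hc] at a1
        exact mul_left_cancel₀ hc (add_right_cancel a1)
      obtain ⟨S, hS, hSd⟩ := lam_deriv f D α lm lp (fun i => φ (Sum.inl i)) j hnet.2.1
        (fun i => he _) hc (fun i => hw.1 _)
      obtain ⟨S', hS', hSd'⟩ := prof_deriv (hnet.2.1 (Sum.inr j)) (he _).1 (he _).2.1 (he _).2.2
        (hw.1 (Sum.inr j))
      have hae : ∀ᵐ ξ ∂(volume : Measure ℝ), ξ ∉ S ∧ ξ ∉ S' :=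
        (hS.ae_notMem volume).and (hS'.ae_notMem volume)
      filter_upwards [ae_scale hc hae] with ξ hξ
      have d1 := hSd _ hξ.1
      have d2 := hSd' _ hξ.2
      rw [hfun] at d2
      refine (d2.unique d1).trans ?_
      refine Finset.sum_congr rfl fun i _ => ?_
      rw [← mul_assoc (spd f lm lp (Sum.inl i) / _), div_mul_cancel₀ _ hc]
  · rintro ⟨lm, lp, hl, hI, hJ, φin, hφ, hae⟩
    have key := fun j => backward hnet hl hI j (hJ j).1 (hJ j).2.1 (hJ j).2.2.1 (hJ j).2.2.2.1
      (hJ j).2.2.2.2 hφ (hae j)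
    refine ⟨lm, lp, Sum.elim φin (lam f α lm lp φin), ?_, ⟨?_, ?_⟩, ?_⟩
    · rintro (i | j)
      · exact hl i
      · exact ⟨(hJ j).1.1, (key j).1, (hJ j).2.1.2⟩
    · rintro (i | j)
      · exact hφ i
      · exact (key j).2.2
    · intro t j
      exact lam_eq f α lm lp φin j (fun i => (hl i).2.1) (key j).2.1 (hJ j).2.2.2.1 t
    · obtain ⟨i, hi⟩ := hI
      exact ⟨Sum.inl i, hi⟩
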